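/- arXiv:math-ph/0008041 — 5 statements merged into one kernel-verified Lean document; each statement's English description precedes it below -/
import Mathlib

section
/- For every β > 0 and every x ∈ ℝ one has the Fourier representation f_β'(x) = -(1/(2π)) ∫_ℝ ((πt/β)/sinh(πt/β)) e^{itx} dt; equivalently, (1/(2π)) ∫_ℝ ((πt/β)/sinh(πt/β)) e^{itx} dt = β/(4 cosh²(βx/2)), where the integrand is understood to take the value 1 at t = 0. -/
open Real Complex

/-- The damping kernel `t ↦ (πt/β)/sinh(πt/β)`, extended by the value `1` at `t = 0`. -/
noncomputable def dampingKernel (β t : ℝ) : ℝ :=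
  if t = 0 then 1 else (Real.pi * t / β) / Real.sinh (Real.pi * t / β)

open MeasureTheory FourierTransform Set

lemma hasDerivAt_sigmoid_mul_left (β u : ℝ) :
    HasDerivAt (fun v : ℝ => sigmoid (β * v)) (β * (sigmoid (β * u) * (1 - sigmoid (β * u)))) u := by
  have h := (hasDerivAt_sigmoid (β * u)).comp u ((hasDerivAt_id u).const_mul β)
  simpa [Function.comp_def, mul_comm] using h

lemma image_sigmoid_mul_left {β : ℝ} (hβ : β ≠ 0) :
    (fun v : ℝ => sigmoid (β * v)) '' univ = Ioo 0 1 := by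
  rw [image_univ, ← range_sigmoid]
  exact (mul_left_surjective₀ hβ).range_comp sigmoid

lemma injective_sigmoid_mul_left {β : ℝ} (hβ : β ≠ 0) :
    Function.Injective (fun v : ℝ => sigmoid (β * v)) :=
  sigmoid_injective.comp (mul_right_injective₀ hβ)

lemma deriv_sigmoid_mul_left_pos {β : ℝ} (hβ : 0 < β) (u : ℝ) :
    0 < β * (sigmoid (β * u) * (1 - sigmoid (β * u))) :=
  mul_pos hβ (mul_pos (sigmoid_pos _) (sub_pos.2 (sigmoid_lt_one _)))

lemma integrable_deriv_sigmoid_mul_left {β : ℝ} (hβ : 0 < β) :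
    Integrable (fun u : ℝ => β * (sigmoid (β * u) * (1 - sigmoid (β * u)))) := by
  have h := (integrableOn_image_iff_integrableOn_abs_deriv_smul MeasurableSet.univ
    (fun u _ => (hasDerivAt_sigmoid_mul_left β u).hasDerivWithinAt)
    (injective_sigmoid_mul_left hβ.ne').injOn (fun _ => (1 : ℝ))).1 (by
      rw [image_sigmoid_mul_left hβ.ne']
      exact integrableOn_const (by simp))
  simpa only [integrableOn_univ, abs_of_pos (deriv_sigmoid_mul_left_pos hβ _), smul_eq_mul,
    mul_one] using h

lemma sigmoid_cpow_mul_one_sub_sigmoid_cpow (u s : ℝ) :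
    (sigmoid u : ℂ) ^ (I * s) * (1 - (sigmoid u : ℂ)) ^ (-(I * s)) = cexp (I * s * u) := by
  have h0 := sigmoid_pos u
  have h1 : 0 < 1 - sigmoid u := sub_pos.2 (sigmoid_lt_one u)
  have hlog : Real.log (1 - sigmoid u) = Real.log (sigmoid u) - u := by
    rw [← sigmoid_neg, ← sigmoid_mul_rexp_neg, Real.log_mul h0.ne' (Real.exp_ne_zero _),
      Real.log_exp, sub_eq_add_neg]
  rw [← ofReal_one, ← ofReal_sub, cpow_def_of_ne_zero (ofReal_ne_zero.2 h0.ne'),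
    cpow_def_of_ne_zero (ofReal_ne_zero.2 h1.ne'), ← ofReal_log h0.le, ← ofReal_log h1.le, hlog,
    ← Complex.exp_add]
  congr 1
  push_cast
  ring

lemma integral_deriv_sigmoid_mul_exp {β : ℝ} (hβ : 0 < β) (s : ℝ) :
    ∫ u : ℝ, ((β * (sigmoid (β * u) * (1 - sigmoid (β * u))) : ℝ) : ℂ) *
        cexp (I * s * (β * u : ℝ)) = betaIntegral (1 + I * s) (1 - I * s) := by
  have h := integral_image_eq_integral_abs_deriv_smul MeasurableSet.univ
    (fun u _ => (hasDerivAt_sigmoid_mul_left β u).hasDerivWithinAt)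
    (injective_sigmoid_mul_left hβ.ne').injOn
    (fun x : ℝ => (x : ℂ) ^ (I * s) * (1 - (x : ℂ)) ^ (-(I * s)))
  rw [image_sigmoid_mul_left hβ.ne', setIntegral_univ] at h
  simp only [abs_of_pos (deriv_sigmoid_mul_left_pos hβ _),
    sigmoid_cpow_mul_one_sub_sigmoid_cpow, real_smul] at h
  rw [← h, betaIntegral, intervalIntegral.integral_of_le zero_le_one, integral_Ioc_eq_integral_Ioo]
  simp only [add_sub_cancel_left, sub_sub_cancel_left]

lemma betaIntegral_one_add_I_mul {s : ℝ} (hs : s ≠ 0) :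
    betaIntegral (1 + I * s) (1 - I * s) = ((π * s / Real.sinh (π * s) : ℝ) : ℂ) := by
  have hs' : I * (s : ℂ) ≠ 0 := mul_ne_zero I_ne_zero (ofReal_ne_zero.2 hs)
  rw [betaIntegral_eq_Gamma_mul_div _ _ (by simp) (by simp), add_comm 1 (I * (s : ℂ)),
    Complex.Gamma_add_one _ hs', mul_assoc, Complex.Gamma_mul_Gamma_one_sub,
    show I * (s : ℂ) + 1 + (1 - I * s) = 2 by ring, Complex.Gamma_ofNat_eq_factorial,
    show (π : ℂ) * (I * s) = (π * s : ℂ) * I by ring, Complex.sin_mul_I]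
  have : Complex.sinh (π * s) ≠ 0 := by
    rw [← ofReal_mul, ← ofReal_sinh, ofReal_ne_zero, Ne, Real.sinh_eq_zero]
    exact mul_ne_zero pi_ne_zero hs
  push_cast
  field_simp
  simp

lemma betaIntegral_eq_dampingKernel (β t : ℝ) (hβ : β ≠ 0) :
    betaIntegral (1 + I * (t / β : ℝ)) (1 - I * (t / β : ℝ)) = (dampingKernel β t : ℂ) := by
  rcases eq_or_ne t 0 with rfl | ht
  · simp [dampingKernel, betaIntegral_eval_one_right]
  · rw [betaIntegral_one_add_I_mul (div_ne_zero ht hβ), dampingKernel, if_neg ht, ← mul_div_assoc]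

lemma dampingKernel_neg (β t : ℝ) : dampingKernel β (-t) = dampingKernel β t := by
  simp [dampingKernel, neg_div, div_neg]

lemma mul_one_add_sq_div_eight_le_sinh {y : ℝ} (hy : 0 ≤ y) :
    y * (1 + y ^ 2 / 8) ≤ Real.sinh y := by
  have h1 : y / 2 ≤ Real.sinh (y / 2) := Real.self_le_sinh_iff.2 (by positivity)
  have h2 : y / 4 ≤ Real.sinh (y / 4) := Real.self_le_sinh_iff.2 (by positivity)
  have h3 : 1 + y ^ 2 / 8 ≤ Real.cosh (y / 2) := by
    rw [show y / 2 = 2 * (y / 4) by ring, Real.cosh_two_mul, Real.cosh_sq]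
    nlinarith
  calc y * (1 + y ^ 2 / 8) = 2 * (y / 2) * (1 + y ^ 2 / 8) := by ring
    _ ≤ 2 * Real.sinh (y / 2) * Real.cosh (y / 2) := by gcongr
    _ = Real.sinh y := by rw [← Real.sinh_two_mul]; congr 1; ring

lemma abs_div_sinh_le (y : ℝ) : |y / Real.sinh y| ≤ 8 * (1 + y ^ 2)⁻¹ := by
  rcases eq_or_ne y 0 with rfl | hy
  · simp
  · have hpos : 0 < |y| := abs_pos.2 hy
    have h := mul_one_add_sq_div_eight_le_sinh hpos.le
    rw [sq_abs] at h
    rw [abs_div, Real.abs_sinh, ← div_eq_mul_inv, div_le_div_iff₀ (by positivity) (by positivity)]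
    nlinarith

lemma integrable_dampingKernel {β : ℝ} (hβ : β ≠ 0) : Integrable (dampingKernel β) := by
  have h : Integrable (fun t : ℝ => 8 * (1 + (π / β * t) ^ 2)⁻¹) :=
    (integrable_inv_one_add_sq.comp_mul_left' (div_ne_zero pi_ne_zero hβ)).const_mul 8
  refine h.mono' (Measurable.aestronglyMeasurable ?_) (.of_forall fun t => ?_)
  · unfold dampingKernel
    exact Measurable.ite (measurableSet_singleton 0) measurable_const (by fun_prop)
  · rw [Real.norm_eq_abs, dampingKernel]
    split_ifs with ht
    · norm_num [ht]
    · rw [← div_mul_eq_mul_div]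
      exact abs_div_sinh_le _

lemma fourier_deriv_sigmoid_mul_left {β : ℝ} (hβ : 0 < β) (w : ℝ) :
    𝓕 (fun u : ℝ => ((β * (sigmoid (β * u) * (1 - sigmoid (β * u))) : ℝ) : ℂ)) w =
      (dampingKernel β (2 * π * w) : ℂ) := by
  rw [← dampingKernel_neg, ← betaIntegral_eq_dampingKernel _ _ hβ.ne',
    ← integral_deriv_sigmoid_mul_exp hβ, fourier_real_eq_integral_exp_smul]
  congr 1 with u
  rw [smul_eq_mul, mul_comm]
  congr 2
  have : (β : ℂ) ≠ 0 := ofReal_ne_zero.2 hβ.ne'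
  push_cast
  field_simp

lemma sigmoid_mul_one_sub_sigmoid (u : ℝ) :
    sigmoid u * (1 - sigmoid u) = 1 / (4 * Real.cosh (u / 2) ^ 2) := by
  rw [← sigmoid_neg, sigmoid_def, sigmoid_def, neg_neg, ← mul_inv, ← one_div]
  congr 1
  have h : Real.exp (u / 2) * Real.exp (-(u / 2)) = 1 := by simp [← Real.exp_add]
  rw [Real.cosh_eq, show u = u / 2 + u / 2 by ring, neg_add, Real.exp_add, Real.exp_add,
    show (u / 2 + u / 2) / 2 = u / 2 by ring]
  linear_combination (Real.exp (u / 2) * Real.exp (-(u / 2)) - 1) * h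

/-- the Fourier representation of the derivative of the Fermi–Dirac
function: `(1/(2π)) ∫ ((πt/β)/sinh(πt/β)) e^{itx} dt = β/(4 cosh²(βx/2))`,
i.e. `f_β'(x) = -(1/(2π)) ∫ ((πt/β)/sinh(πt/β)) e^{itx} dt`. -/
theorem fourier_rep_fermi_deriv (β : ℝ) (hβ : 0 < β) (x : ℝ) :
    (1 / (2 * Real.pi) : ℂ) *
        ∫ t : ℝ, (dampingKernel β t : ℂ) * Complex.exp (Complex.I * t * x)
      = ((β / (4 * Real.cosh (β * x / 2) ^ 2) : ℝ) : ℂ) := by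
  have hF : 𝓕 (fun u : ℝ => ((β * (sigmoid (β * u) * (1 - sigmoid (β * u))) : ℝ) : ℂ)) =
      fun w : ℝ => (dampingKernel β (2 * π * w) : ℂ) :=
    funext (fourier_deriv_sigmoid_mul_left hβ)
  have hcont : Continuous
      (fun u : ℝ => ((β * (sigmoid (β * u) * (1 - sigmoid (β * u))) : ℝ) : ℂ)) := by
    fun_prop
  have hint : Integrable (fun w : ℝ => (dampingKernel β (2 * π * w) : ℂ)) :=
    ((integrable_dampingKernel hβ.ne').comp_mul_left' two_pi_pos.ne').ofReal
  have hinv := congrFun (hcont.fourierInv_fourier_eq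
    (integrable_deriv_sigmoid_mul_left hβ).ofReal (hF ▸ hint)) x
  rw [hF, fourierInv_eq'] at hinv
  have hscale := Measure.integral_comp_mul_left
    (fun t : ℝ => (dampingKernel β t : ℂ) * cexp (I * t * x)) (2 * π)
  rw [abs_of_pos (by positivity), real_smul] at hscale
  rw [div_eq_mul_one_div β, ← sigmoid_mul_one_sub_sigmoid, ← hinv]
  push_cast at hscale
  rw [one_div, ← hscale]
  congr 1 with w
  rw [smul_eq_mul, mul_comm]
  congr 2
  simp only [RCLike.inner_apply, conj_trivial]
  push_cast
  ring
end

section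
/- Let R be a unital ring, let h, k ∈ R, let z be a central element of R, and suppose u := h - z is invertible with inverse r = u^{-1}. Then the iterated commutator expansion r·k·r = k·r² - [h,k]·r³ + [h,[h,k]]·r⁴ - r·[h,[h,[h,k]]]·r⁴ holds, where [x,y] = x·y - y·x. -/
/-- Moving the inverse of a unit past `a` produces a commutator with the unit. -/
theorem Units.inv_mul_eq_mul_inv_sub {R : Type*} [Ring R] (u : Rˣ) (a : R) :
    (↑u⁻¹ : R) * a = a * ↑u⁻¹ - ↑u⁻¹ * (↑u * a - a * ↑u) * ↑u⁻¹ := by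
  simp [mul_sub, sub_mul, mul_assoc]

/-- the iterated commutator expansion of the resolvent. In a
unital ring `R`, if `z` is central and `u = h - z` is invertible with inverse
`r`, then `r·k·r = k·r² - [h,k]·r³ + [h,[h,k]]·r⁴ - r·[h,[h,[h,k]]]·r⁴`,
where `[x,y] = x·y - y·x`. -/
theorem resolvent_iterated_commutator {R : Type*} [Ring R] (h k z : R)
    (hz : ∀ x : R, z * x = x * z) (u : Rˣ) (hu : (u : R) = h - z) :
    (↑u⁻¹ : R) * k * (↑u⁻¹ : R)
      = k * (↑u⁻¹ : R) ^ 2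
        - (h * k - k * h) * (↑u⁻¹ : R) ^ 3
        + (h * (h * k - k * h) - (h * k - k * h) * h) * (↑u⁻¹ : R) ^ 4
        - (↑u⁻¹ : R) *
            (h * (h * (h * k - k * h) - (h * k - k * h) * h)
              - (h * (h * k - k * h) - (h * k - k * h) * h) * h) * (↑u⁻¹ : R) ^ 4 := by
  have comm_eq (a : R) : h * a - a * h = ↑u * a - a * ↑u := by
    rw [hu, sub_mul, mul_sub, hz a]
    abel
  have move (a : R) :
      (↑u⁻¹ : R) * a = a * ↑u⁻¹ - ↑u⁻¹ * (h * a - a * h) * ↑u⁻¹ := by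
    rw [comm_eq]
    exact u.inv_mul_eq_mul_inv_sub a
  generalize (↑u⁻¹ : R) = r at move ⊢
  have move₁ := move (h * k - k * h)
  have move₂ := move (h * (h * k - k * h) - (h * k - k * h) * h)
  rw [move k]
  generalize h * (h * (h * k - k * h) - (h * k - k * h) * h)
    - (h * (h * k - k * h) - (h * k - k * h) * h) * h = c₃ at *
  generalize h * (h * k - k * h) - (h * k - k * h) * h = c₂ at *
  generalize h * k - k * h = c₁ at *
  rw [move₁, move₂]
  noncomm_ring
end

section
/- Let a : ℝⁿ → ℝⁿ and V : ℝⁿ → ℝ be twice continuously differentiable, let κ ∈ ℝ, and let H(q,p) = ½‖p - κa(q)‖² + V(q). Then at every point (q,p) ∈ ℝⁿ × ℝⁿ, Σ_{j,k=1}^n [ (∂²H/∂q_j∂p_k)(∂²H/∂p_j∂q_k) - (∂²H/∂q_j∂q_k)(∂²H/∂p_j∂p_k) ] = -κ² Σ_{1≤j<k≤n} (∂a_k/∂q_j - ∂a_j/∂q_k)² + κ Σ_{m=1}^n (p_m - κa_m(q)) Δa_m(q) - ΔV(q), where Δ denotes the Laplacian in q and the magnetic field components are B_{jk} = ∂a_j/∂q_k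 - ∂a_k/∂q_j. -/
/-- Partial derivative in the `j`-th coordinate of a function on `ℝⁿ`. -/
noncomputable def pd {n : ℕ} (j : Fin n) (f : (Fin n → ℝ) → ℝ) (x : Fin n → ℝ) : ℝ :=
  deriv (fun s => f (Function.update x j s)) (x j)

/-- The classical magnetic Hamiltonian `H(q,p) = ½‖p - κa(q)‖² + V(q)` in coordinates. -/
noncomputable def Hcl {n : ℕ} (κ : ℝ) (a : (Fin n → ℝ) → (Fin n → ℝ)) (V : (Fin n → ℝ) → ℝ)
    (q p : Fin n → ℝ) : ℝ :=
  (1 / 2) * ∑ m, (p m - κ * a q m) ^ 2 + V q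

theorem hasDerivAt_pd {n : ℕ} (j : Fin n) {f : (Fin n → ℝ) → ℝ} {x : Fin n → ℝ}
    (hf : DifferentiableAt ℝ f x) :
    HasDerivAt (fun s => f (Function.update x j s)) (pd j f x) (x j) := by
  have hu : HasDerivAt (Function.update x j) (Pi.single j (1 : ℝ)) (x j) :=
    hasDerivAt_update x j (x j)
  have hf' : DifferentiableAt ℝ f (Function.update x j (x j)) := by
    rwa [Function.update_eq_self]
  exact (hf'.comp (x j) hu.differentiableAt).hasDerivAt

theorem pd_eq_fderiv {n : ℕ} (j : Fin n) {f : (Fin n → ℝ) → ℝ} {x : Fin n → ℝ}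
    (hf : DifferentiableAt ℝ f x) : pd j f x = fderiv ℝ f x (Pi.single j 1) := by
  have hu : HasDerivAt (Function.update x j) (Pi.single j (1 : ℝ)) (x j) :=
    hasDerivAt_update x j (x j)
  have hf' : HasFDerivAt f (fderiv ℝ f x) (Function.update x j (x j)) := by
    rw [Function.update_eq_self]
    exact hf.hasFDerivAt
  exact (hf'.comp_hasDerivAt (x j) hu).deriv

theorem differentiable_pd {n : ℕ} (j : Fin n) {f : (Fin n → ℝ) → ℝ} (hf : ContDiff ℝ 2 f) :
    Differentiable ℝ (pd j f) := by
  have h : pd j f = fun x => fderiv ℝ f x (Pi.single j 1) :=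
    funext fun x => pd_eq_fderiv j (hf.differentiable (by norm_num) x)
  rw [h]
  have h1 : ContDiff ℝ 1 (fderiv ℝ f) := hf.fderiv_right (by norm_num)
  exact (h1.differentiable (by norm_num)).clm_apply (differentiable_const _)

theorem pd_coord {n : ℕ} (j k : Fin n) (x : Fin n → ℝ) :
    pd j (fun y => y k) x = if j = k then 1 else 0 := by
  rw [pd_eq_fderiv j (differentiableAt_apply k x), (hasFDerivAt_apply k x).fderiv]
  simp [Pi.single_apply, eq_comm]

theorem pd_position_Hcl {n : ℕ} (k : Fin n) {a : (Fin n → ℝ) → (Fin n → ℝ)}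
    {V : (Fin n → ℝ) → ℝ} (κ : ℝ) (q p : Fin n → ℝ)
    (ha : ∀ m, DifferentiableAt ℝ (fun q' => a q' m) q) (hV : DifferentiableAt ℝ V q) :
    pd k (fun q' => Hcl κ a V q' p) q =
      (∑ m, -κ * ((p m - κ * a q m) * pd k (fun q' => a q' m) q)) + pd k V q := by
  have h := ((HasDerivAt.fun_sum (u := Finset.univ) fun m _ =>
    (((hasDerivAt_pd k (ha m)).const_mul κ).const_sub (p m)).fun_pow 2).const_mul
      (1 / 2 : ℝ)).add (hasDerivAt_pd k hV)
  refine h.deriv.trans ?_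
  rw [Finset.mul_sum, Function.update_eq_self]
  congr 1
  refine Finset.sum_congr rfl fun m _ => ?_
  push_cast
  ring

theorem pd_momentum_Hcl {n : ℕ} (k : Fin n) (a : (Fin n → ℝ) → (Fin n → ℝ))
    (V : (Fin n → ℝ) → ℝ) (κ : ℝ) (q p : Fin n → ℝ) :
    pd k (Hcl κ a V q) p = p k - κ * a q k := by
  have h := ((HasDerivAt.fun_sum (u := Finset.univ) fun m _ =>
    ((hasDerivAt_pd k (differentiableAt_apply m p)).sub_const (κ * a q m)).fun_pow 2).const_mul
      (1 / 2 : ℝ)).add_const (V q)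
  refine h.deriv.trans ?_
  simp [Function.update_eq_self, pd_coord]

theorem sum_mul_swap_sub_sum_sq {n : ℕ} (A : Fin n → Fin n → ℝ) :
    (∑ j, ∑ k, (A j k * A k j - A j k ^ 2)) =
      -∑ j, ∑ k, if j < k then (A j k - A k j) ^ 2 else 0 := by
  have h1 : (∑ j, ∑ k, (A j k - A k j) ^ 2) =
      (∑ j, ∑ k, if j < k then (A j k - A k j) ^ 2 else 0) +
        ∑ j, ∑ k, if k < j then (A k j - A j k) ^ 2 else 0 := by
    simp only [← Finset.sum_add_distrib]
    refine Finset.sum_congr rfl fun j _ => Finset.sum_congr rfl fun k _ => ?_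
    rcases lt_trichotomy j k with h | rfl | h
    · simp [h, h.not_gt]
    · simp
    · rw [if_neg h.not_gt, if_pos h]
      ring
  have h2 : (∑ j, ∑ k, if k < j then (A k j - A j k) ^ 2 else 0) =
      ∑ j, ∑ k, if j < k then (A j k - A k j) ^ 2 else 0 := Finset.sum_comm
  have h3 : (∑ j, ∑ k, (A j k - A k j) ^ 2) =
      (∑ j, ∑ k, A j k ^ 2) + (∑ j, ∑ k, A k j ^ 2) - 2 * ∑ j, ∑ k, A j k * A k j := by
    simp only [Finset.mul_sum, ← Finset.sum_add_distrib, ← Finset.sum_sub_distrib]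
    refine Finset.sum_congr rfl fun j _ => Finset.sum_congr rfl fun k _ => ?_
    ring
  have h4 : (∑ j, ∑ k, A k j ^ 2) = ∑ j, ∑ k, A j k ^ 2 := Finset.sum_comm
  simp only [Finset.sum_sub_distrib]
  linarith

/-- the explicit computation of the subprincipal coefficient:
`Σ_{j,k} [(∂²H/∂q_j∂p_k)(∂²H/∂p_j∂q_k) - (∂²H/∂q_j∂q_k)(∂²H/∂p_j∂p_k)]
  = -κ² Σ_{j<k} (∂a_k/∂q_j - ∂a_j/∂q_k)² + κ Σ_m (p_m - κa_m(q)) Δa_m(q) - ΔV(q)`. -/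
theorem d22_explicit {n : ℕ} (a : (Fin n → ℝ) → (Fin n → ℝ)) (V : (Fin n → ℝ) → ℝ)
    (ha : ContDiff ℝ 2 a) (hV : ContDiff ℝ 2 V) (κ : ℝ) (q p : Fin n → ℝ) :
    (∑ j, ∑ k,
        (pd j (fun q' => pd k (Hcl κ a V q') p) q
            * pd j (fun p' => pd k (fun q' => Hcl κ a V q' p') q) p
          - pd j (fun q' => pd k (fun q'' => Hcl κ a V q'' p) q') q
            * pd j (fun p' => pd k (Hcl κ a V q) p') p))
      = -κ ^ 2 * (∑ j, ∑ k, if j < k then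
            (pd j (fun q' => a q' k) q - pd k (fun q' => a q' j) q) ^ 2 else 0)
        + κ * (∑ m, (p m - κ * a q m) *
            (∑ j, pd j (fun q' => pd j (fun q'' => a q'' m) q') q))
        - ∑ j, pd j (fun q' => pd j V q') q := by
  have ha2 (m : Fin n) : ContDiff ℝ 2 fun q' => a q' m := contDiff_pi.1 ha m
  have ha1 (m : Fin n) : Differentiable ℝ fun q' => a q' m :=
    (ha2 m).differentiable (by norm_num)
  have hV1 : Differentiable ℝ V := hV.differentiable (by norm_num)
  have hq (k : Fin n) (q' p' : Fin n → ℝ) := pd_position_Hcl k κ q' p' (fun m => ha1 m q') (hV1 q')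
  have hqp (j k : Fin n) : pd j (fun q' => p k - κ * a q' k) q =
      -(κ * pd j (fun q' => a q' k) q) :=
    (((hasDerivAt_pd j (ha1 k q)).const_mul κ).const_sub (p k)).deriv
  have hpp (j k : Fin n) : pd j (fun p' => p' k - κ * a q k) p = if j = k then 1 else 0 := by
    rw [← pd_coord j k p]
    exact ((hasDerivAt_pd j (differentiableAt_apply k p)).sub_const (κ * a q k)).deriv
  have hpq (j k : Fin n) :
      pd j (fun p' => (∑ m, -κ * ((p' m - κ * a q m) * pd k (fun q' => a q' m) q)) + pd k V q) p =
        -(κ * pd k (fun q' => a q' j) q) := by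
    have h := (HasDerivAt.fun_sum (u := Finset.univ) fun m _ =>
      (((hasDerivAt_pd j (differentiableAt_apply m p)).sub_const (κ * a q m)).mul_const
        (pd k (fun q' => a q' m) q)).const_mul (-κ)).add_const (pd k V q)
    refine h.deriv.trans ?_
    simp [pd_coord]
  have hqq (j : Fin n) :
      pd j (fun q' => (∑ m, -κ * ((p m - κ * a q' m) * pd j (fun q' => a q' m) q')) + pd j V q') q =
        κ ^ 2 * (∑ m, pd j (fun q' => a q' m) q ^ 2)
          - κ * (∑ m, (p m - κ * a q m) * pd j (fun q' => pd j (fun q'' => a q'' m) q') q)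
          + pd j (fun q' => pd j V q') q := by
    have h := (HasDerivAt.fun_sum (u := Finset.univ) fun m _ =>
      ((((hasDerivAt_pd j (ha1 m q)).const_mul κ).const_sub (p m)).fun_mul
        (hasDerivAt_pd j (differentiable_pd j (ha2 m) q))).const_mul (-κ)).add
          (hasDerivAt_pd j (differentiable_pd j hV q))
    refine h.deriv.trans ?_
    rw [Function.update_eq_self, Finset.mul_sum, Finset.mul_sum, ← Finset.sum_sub_distrib]
    congr 1
    refine Finset.sum_congr rfl fun m _ => ?_
    ring
  have hA := sum_mul_swap_sub_sum_sq fun j k => pd j (fun q' => a q' k) q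
  have hL : (∑ m, (p m - κ * a q m) * ∑ j, pd j (fun q' => pd j (fun q'' => a q'' m) q') q) =
      ∑ j, ∑ m, (p m - κ * a q m) * pd j (fun q' => pd j (fun q'' => a q'' m) q') q := by
    simp only [Finset.mul_sum]
    exact Finset.sum_comm
  simp only [pd_momentum_Hcl, hq, hqp, hpp, hpq, mul_ite, mul_one, mul_zero,
    Finset.sum_sub_distrib, Finset.sum_ite_eq, Finset.mem_univ, if_true, hqq]
  rw [hL, neg_mul, ← mul_neg, ← hA]
  simp only [Finset.sum_sub_distrib, Finset.sum_add_distrib, ← Finset.mul_sum, neg_mul_neg,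
    mul_mul_mul_comm κ _ κ _]
  ring
end

section
/- Let H : ℝⁿ × ℝⁿ → ℝ be three times continuously differentiable with H ≥ 1, suppose there are c₀, s > 0 with H(z) ≥ c₀(1 + ‖z‖)^s for all z ∈ ℝ²ⁿ, and suppose that for every multi-index α with |α| ≤ 3 there is C_α with |∂^α H| ≤ C_α H. Let F : ℝ → ℝ be three times continuously differentiable such that for k = 2, 3 and every N there is C_N with |F^{(k)}(t)| ≤ C_N(1+|t|)^{-N} for all t. Then for every μ ∈ ℝ both of the following integrals over ℝⁿ × ℝⁿ converge and are equal: ∫∫ F^{(3)}(H-μ)·Σ_{j,k}[(∂_{q_j}H)(∂²_{p_jp_k}H)(∂_{q_k}H) - 2(∂_{q_j}H)(∂_{p_k}H)(∂²_{p_jq_k}H) + (∂_{p_j}H)(∂_{p_k}H)(∂²_{q_jq_k}H)] dq dp = 2 ∫∫ F^{(2)}(H-μ)·Σ_{j,k}[(∂²_{q_jp_k}H)(∂²_{p_jq_k}H) - (∂²_{q_jq_k}H)(∂²_{p_jp_k}H)] dq dp. -/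
open MeasureTheory

/-- Partial derivative in the `j`-th position coordinate of a function on phase space. -/
noncomputable def pdq {n : ℕ} (j : Fin n) (f : (Fin n → ℝ) × (Fin n → ℝ) → ℝ)
    (z : (Fin n → ℝ) × (Fin n → ℝ)) : ℝ :=
  deriv (fun s => f (Function.update z.1 j s, z.2)) (z.1 j)

/-- Partial derivative in the `k`-th momentum coordinate of a function on phase space. -/
noncomputable def pdp {n : ℕ} (k : Fin n) (f : (Fin n → ℝ) × (Fin n → ℝ) → ℝ)
    (z : (Fin n → ℝ) × (Fin n → ℝ)) : ℝ :=
  deriv (fun s => f (z.1, Function.update z.2 k s)) (z.2 k)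

section Dominated

variable {E : Type*} [NormedAddCommGroup E] [NormedSpace ℝ E]

/-- The derivative of `f` in the constant direction `v`. -/
noncomputable def dirDeriv (v : E) (f : E → ℝ) (z : E) : ℝ := fderiv ℝ f z v

/-- `f` is of class `C^m` and its derivatives up to order `m` are bounded by multiples of `w`. -/
def IsDominated (w : E → ℝ) (m : ℕ) (f : E → ℝ) : Prop :=
  ContDiff ℝ m f ∧ ∀ k ≤ m, ∃ C : ℝ, ∀ z, ‖iteratedFDeriv ℝ k f z‖ ≤ C * w z

/-- `g` decays faster than every inverse power. -/
def HasRapidDecay (g : ℝ → ℝ) : Prop :=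
  ∀ N : ℕ, ∃ C : ℝ, ∀ t : ℝ, |g t| ≤ C / (1 + |t|) ^ N

variable {w f : E → ℝ} {m : ℕ}

lemma IsDominated.dirDeriv (hf : IsDominated w (m + 1) f) (v : E) :
    IsDominated w m (dirDeriv v f) := by
  have hd : ContDiff ℝ m (fderiv ℝ f) := hf.1.fderiv_right (by norm_cast)
  refine ⟨hd.clm_apply contDiff_const, fun k hk => ?_⟩
  obtain ⟨C, hC⟩ := hf.2 (k + 1) (by omega)
  refine ⟨‖v‖ * C, fun z => ?_⟩
  calc ‖iteratedFDeriv ℝ k (fun y => fderiv ℝ f y v) z‖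
      ≤ ‖v‖ * ‖iteratedFDeriv ℝ k (fderiv ℝ f) z‖ :=
        norm_iteratedFDeriv_clm_apply_const hd.contDiffAt (by exact_mod_cast hk)
    _ ≤ ‖v‖ * (C * w z) := by
        rw [norm_iteratedFDeriv_fderiv]
        gcongr
        exact hC z
    _ = ‖v‖ * C * w z := by ring

lemma IsDominated.mono {l : ℕ} (hf : IsDominated w m f) (hl : l ≤ m) : IsDominated w l f :=
  ⟨hf.1.of_le (by exact_mod_cast hl), fun k hk => hf.2 k (hk.trans hl)⟩

lemma IsDominated.abs_le (hf : IsDominated w m f) : ∃ C : ℝ, ∀ z, |f z| ≤ C * w z := by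
  obtain ⟨C, hC⟩ := hf.2 0 (Nat.zero_le _)
  exact ⟨C, fun z => by simpa using hC z⟩

lemma IsDominated.one (hw : ∀ z, 1 ≤ w z) : IsDominated w 0 (fun _ => 1) := by
  refine ⟨contDiff_const, fun k hk => ⟨1, fun z => ?_⟩⟩
  obtain rfl : k = 0 := by omega
  simpa using hw z

lemma IsDominated.differentiable (hf : IsDominated w (m + 1) f) : Differentiable ℝ f :=
  hf.1.differentiable (by norm_cast)

lemma dirDeriv_comm (hf : ContDiff ℝ 2 f) (u v : E) :
    dirDeriv u (dirDeriv v f) = dirDeriv v (dirDeriv u f) := by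
  have hd : Differentiable ℝ (fderiv ℝ f) :=
    (hf.fderiv_right (m := 1) (by norm_num)).differentiable (by norm_num)
  have key : ∀ a b z, dirDeriv a (dirDeriv b f) z = fderiv ℝ (fderiv ℝ f) z a b := by
    intro a b z
    change fderiv ℝ (fun y => fderiv ℝ f y b) z a = _
    rw [fderiv_clm_apply (hd z) (differentiableAt_const b)]
    simp
  funext z
  rw [key, key]
  exact (hf.contDiffAt.isSymmSndFDerivAt (by simp)).eq u v

lemma dirDeriv_mul {g : E → ℝ} (hf : Differentiable ℝ f) (hg : Differentiable ℝ g) (v z : E) :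
    dirDeriv v (fun y => f y * g y) z = dirDeriv v f z * g z + f z * dirDeriv v g z := by
  simp only [dirDeriv, fderiv_fun_mul (hf z) (hg z)]
  simp
  ring

lemma dirDeriv_comp_sub_const {g : ℝ → ℝ} (hg : Differentiable ℝ g) (hf : Differentiable ℝ f)
    (μ : ℝ) (v z : E) :
    dirDeriv v (fun y => g (f y - μ)) z = deriv g (f z - μ) * dirDeriv v f z := by
  have h := (hg (f z - μ)).hasDerivAt.comp_hasFDerivAt z ((hf z).hasFDerivAt.sub_const μ)
  simp only [dirDeriv]
  rw [show fderiv ℝ (fun y => g (f y - μ)) z = _ from h.fderiv]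
  simp

end Dominated

section Integration

variable {E : Type*} [NormedAddCommGroup E] [NormedSpace ℝ E] [FiniteDimensional ℝ E]
  [MeasurableSpace E] [BorelSpace E] {ν : Measure E} [ν.IsAddHaarMeasure]
  {H : E → ℝ} {c₀ s : ℝ}

lemma le_mul_one_add_abs_sub (h μ : ℝ) : h ≤ (1 + |μ|) * (1 + |h - μ|) := by
  have h1 := le_abs_self (h - μ)
  have h2 := le_abs_self μ
  nlinarith [mul_nonneg (abs_nonneg μ) (abs_nonneg (h - μ))]

lemma integrable_comp_mul_mul_mul (hHc : Continuous H) (hH1 : ∀ z, 1 ≤ H z) (hc₀ : 0 < c₀)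
    (hs : 0 < s) (hgrow : ∀ z, c₀ * (1 + ‖z‖) ^ s ≤ H z) {g : ℝ → ℝ} (hg : Continuous g)
    (hdec : HasRapidDecay g) (μ : ℝ) {f₁ f₂ f₃ : E → ℝ} (h₁ : IsDominated H 0 f₁)
    (h₂ : IsDominated H 0 f₂) (h₃ : IsDominated H 0 f₃) :
    Integrable (fun z => g (H z - μ) * (f₁ z * f₂ z * f₃ z)) ν := by
  obtain ⟨C₁, hC₁⟩ := h₁.abs_le
  obtain ⟨C₂, hC₂⟩ := h₂.abs_le
  obtain ⟨C₃, hC₃⟩ := h₃.abs_le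
  obtain ⟨M, hM⟩ := exists_nat_gt ((Module.finrank ℝ E : ℝ) / s)
  have hMs : (Module.finrank ℝ E : ℝ) < s * M := by
    rw [div_lt_iff₀ hs] at hM
    linarith
  obtain ⟨C, hC⟩ := hdec (M + 3)
  have hC0 : 0 ≤ C := by simpa using (abs_nonneg _).trans (hC 0)
  have hint := (integrable_one_add_norm (μ := ν) hMs).const_mul
    (C * (1 + |μ|) ^ (M + 3) * |C₁| * |C₂| * |C₃| * (c₀ ^ M)⁻¹)
  have hc : Continuous fun z => g (H z - μ) * (f₁ z * f₂ z * f₃ z) := by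
    have := h₁.1.continuous
    have := h₂.1.continuous
    have := h₃.1.continuous
    fun_prop
  refine hint.mono' hc.aestronglyMeasurable (Filter.Eventually.of_forall fun z => ?_)
  have hHz : 0 < H z := one_pos.trans_le (hH1 z)
  have hbd : ∀ {C' y : ℝ}, |y| ≤ C' * H z → |y| ≤ |C'| * H z := fun h =>
    h.trans (mul_le_mul_of_nonneg_right (le_abs_self _) hHz.le)
  have hgz : |g (H z - μ)| ≤ C * (1 + |μ|) ^ (M + 3) / H z ^ (M + 3) := by
    refine (hC _).trans ?_
    rw [div_le_div_iff₀ (by positivity) (by positivity), mul_assoc, ← mul_pow]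
    gcongr
    exact le_mul_one_add_abs_sub (H z) μ
  have hpow : (H z ^ M)⁻¹ ≤ (c₀ ^ M)⁻¹ * (1 + ‖z‖) ^ (-(s * M)) := by
    have h0 : (0 : ℝ) < 1 + ‖z‖ := by positivity
    rw [Real.rpow_neg h0.le, Real.rpow_mul h0.le, Real.rpow_natCast, ← mul_inv, ← mul_pow]
    gcongr
    exact hgrow z
  rw [Real.norm_eq_abs, abs_mul, abs_mul, abs_mul]
  calc |g (H z - μ)| * (|f₁ z| * |f₂ z| * |f₃ z|)
      ≤ C * (1 + |μ|) ^ (M + 3) / H z ^ (M + 3)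
          * (|C₁| * H z * (|C₂| * H z) * (|C₃| * H z)) := by
        gcongr
        exacts [hbd (hC₁ z), hbd (hC₂ z), hbd (hC₃ z)]
    _ = C * (1 + |μ|) ^ (M + 3) * |C₁| * |C₂| * |C₃| * (H z ^ M)⁻¹ := by
        field_simp
        ring
    _ ≤ C * (1 + |μ|) ^ (M + 3) * |C₁| * |C₂| * |C₃| *
          ((c₀ ^ M)⁻¹ * (1 + ‖z‖) ^ (-(s * M))) := by gcongr
    _ = _ := by ring

variable (hH1 : ∀ z, 1 ≤ H z) (hc₀ : 0 < c₀) (hs : 0 < s)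
  (hgrow : ∀ z, c₀ * (1 + ‖z‖) ^ s ≤ H z) {g : ℝ → ℝ} (hg : ContDiff ℝ 1 g)
  (hdec : HasRapidDecay g) (hdec' : HasRapidDecay (deriv g)) (μ : ℝ)
include hH1 hc₀ hs hgrow

lemma integrable_comp_mul_mul (hHc : Continuous H) (hg : Continuous g)
    (hdec : HasRapidDecay g) {f₁ f₂ : E → ℝ} (h₁ : IsDominated H 0 f₁)
    (h₂ : IsDominated H 0 f₂) :
    Integrable (fun z => g (H z - μ) * (f₁ z * f₂ z)) ν := by
  simpa using integrable_comp_mul_mul_mul hHc hH1 hc₀ hs hgrow hg hdec μ h₁ h₂ (.one hH1)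

include hg hdec hdec'

lemma integral_deriv_comp_mul_dirDeriv (hH : IsDominated H 1 H) {a b : E → ℝ}
    (ha : IsDominated H 1 a) (hb : IsDominated H 1 b) (v : E) :
    ∫ z, deriv g (H z - μ) * (dirDeriv v H z * a z * b z) ∂ν
      = -∫ z, g (H z - μ) * (dirDeriv v a z * b z + a z * dirDeriv v b z) ∂ν := by
  have hHc := hH.1.continuous
  have hgd : Differentiable ℝ g := hg.differentiable (by norm_num)
  have hHd : Differentiable ℝ H := hH.differentiable
  have ha0 := ha.mono (Nat.zero_le 1)
  have hb0 := hb.mono (Nat.zero_le 1)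
  have hleft : ∀ z, deriv g (H z - μ) * (dirDeriv v H z * a z * b z)
      = dirDeriv v (fun y => g (H y - μ)) z * (a z * b z) := fun z => by
    rw [dirDeriv_comp_sub_const hgd hHd]
    ring
  have hright : ∀ z, g (H z - μ) * (dirDeriv v a z * b z + a z * dirDeriv v b z)
      = g (H z - μ) * dirDeriv v (fun y => a y * b y) z := fun z => by
    rw [dirDeriv_mul ha.differentiable hb.differentiable]
  have i₁ := integrable_comp_mul_mul_mul (ν := ν) hHc hH1 hc₀ hs hgrow
    (hg.continuous_deriv (by norm_num)) hdec' μ (hH.dirDeriv v) ha0 hb0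
  have i₂ := (integrable_comp_mul_mul (ν := ν) hH1 hc₀ hs hgrow μ hHc hg.continuous hdec
    (ha.dirDeriv v) hb0).add (integrable_comp_mul_mul (ν := ν) hH1 hc₀ hs hgrow μ hHc
    hg.continuous hdec ha0 (hb.dirDeriv v))
  have i₃ := integrable_comp_mul_mul (ν := ν) hH1 hc₀ hs hgrow μ hHc hg.continuous hdec ha0 hb0
  have i₂' : Integrable (fun z => g (H z - μ) *
      (dirDeriv v a z * b z + a z * dirDeriv v b z)) ν := by
    refine i₂.congr (Filter.Eventually.of_forall fun z => ?_)
    simp only [Pi.add_apply]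
    ring
  simp only [hleft] at i₁ ⊢
  simp only [hright] at i₂' ⊢
  have := integral_mul_fderiv_eq_neg_fderiv_mul_of_integrable i₁ i₂' i₃
    (fun z _ => (hgd _).comp z ((hHd z).sub_const μ))
    (fun z _ => (ha.differentiable z).mul (hb.differentiable z))
  simp only [dirDeriv] at this ⊢
  rw [this, neg_neg]

/-- Integration by parts for the four mixed terms attached to directions `a`, `b`, `c`, `d`. -/
lemma integral_deriv_comp_mul_hessian (hH : IsDominated H 3 H) (a b c d : E) :
    Integrable (fun z => deriv g (H z - μ) *
      (dirDeriv a H z * dirDeriv b H z * dirDeriv c (dirDeriv d H) z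
        - dirDeriv a H z * dirDeriv d H z * dirDeriv c (dirDeriv b H) z
        - dirDeriv c H z * dirDeriv b H z * dirDeriv d (dirDeriv a H) z
        + dirDeriv c H z * dirDeriv d H z * dirDeriv a (dirDeriv b H) z)) ν ∧
    Integrable (fun z => g (H z - μ) *
      (dirDeriv a (dirDeriv d H) z * dirDeriv c (dirDeriv b H) z
        - dirDeriv a (dirDeriv b H) z * dirDeriv c (dirDeriv d H) z)) ν ∧
    ∫ z, deriv g (H z - μ) *
      (dirDeriv a H z * dirDeriv b H z * dirDeriv c (dirDeriv d H) z
        - dirDeriv a H z * dirDeriv d H z * dirDeriv c (dirDeriv b H) z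
        - dirDeriv c H z * dirDeriv b H z * dirDeriv d (dirDeriv a H) z
        + dirDeriv c H z * dirDeriv d H z * dirDeriv a (dirDeriv b H) z) ∂ν
      = 2 * ∫ z, g (H z - μ) *
        (dirDeriv a (dirDeriv d H) z * dirDeriv c (dirDeriv b H) z
          - dirDeriv a (dirDeriv b H) z * dirDeriv c (dirDeriv d H) z) ∂ν := by
  have hHc := hH.1.continuous
  have hg' := hg.continuous_deriv (by norm_num)
  have hH1' : IsDominated H 1 H := hH.mono (by norm_num)
  have d₁ : ∀ v, IsDominated H 1 (dirDeriv v H) := fun v => (hH.dirDeriv v).mono (by norm_num)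
  have d₂ : ∀ u v, IsDominated H 1 (dirDeriv u (dirDeriv v H)) :=
    fun u v => (hH.dirDeriv v).dirDeriv u
  have d₁' : ∀ v, IsDominated H 0 (dirDeriv v H) := fun v => (d₁ v).mono (by norm_num)
  have d₂' : ∀ u v, IsDominated H 0 (dirDeriv u (dirDeriv v H)) :=
    fun u v => (d₂ u v).mono (by norm_num)
  have hcomm : ∀ u v, dirDeriv u (dirDeriv v H) = dirDeriv v (dirDeriv u H) :=
    dirDeriv_comm (hH.mono (by norm_num : 2 ≤ 3)).1
  have hcomm' : ∀ t u v, dirDeriv t (dirDeriv u (dirDeriv v H)) =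
      dirDeriv u (dirDeriv t (dirDeriv v H)) := fun t u v => dirDeriv_comm (hH.dirDeriv v).1 t u
  have J : ∀ t u v x, Integrable (fun z => deriv g (H z - μ) *
      (dirDeriv t H z * dirDeriv u H z * dirDeriv v (dirDeriv x H) z)) ν := fun t u v x =>
    integrable_comp_mul_mul_mul hHc hH1 hc₀ hs hgrow hg' hdec' μ (d₁' t) (d₁' u) (d₂' v x)
  have K : ∀ t u v x, Integrable (fun z => g (H z - μ) *
      (dirDeriv t (dirDeriv u H) z * dirDeriv v (dirDeriv x H) z)) ν := fun t u v x =>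
    integrable_comp_mul_mul hH1 hc₀ hs hgrow μ hHc hg.continuous hdec (d₂' t u) (d₂' v x)
  have L : ∀ t u v x, Integrable (fun z => g (H z - μ) *
      (dirDeriv t H z * dirDeriv u (dirDeriv v (dirDeriv x H)) z)) ν := fun t u v x =>
    integrable_comp_mul_mul hH1 hc₀ hs hgrow μ hHc hg.continuous hdec (d₁' t)
      ((d₂ v x).dirDeriv u)
  have P : ∀ t u v x, ∫ z, deriv g (H z - μ) *
      (dirDeriv t H z * dirDeriv u H z * dirDeriv v (dirDeriv x H) z) ∂ν
      = -(∫ z, g (H z - μ) * (dirDeriv t (dirDeriv u H) z * dirDeriv v (dirDeriv x H) z) ∂ν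
        + ∫ z, g (H z - μ) *
          (dirDeriv u H z * dirDeriv t (dirDeriv v (dirDeriv x H)) z) ∂ν) := fun t u v x => by
    rw [integral_deriv_comp_mul_dirDeriv hH1 hc₀ hs hgrow hg hdec hdec' μ hH1' (d₁ u) (d₂ v x) t,
      ← integral_add (K t u v x) (L u t v x)]
    simp only [mul_add]
  simp only [mul_add, mul_sub]
  refine ⟨(((J a b c d).sub (J a d c b)).sub (J c b d a)).add (J c d a b),
    (K a d c b).sub (K a b c d), ?_⟩
  refine (integral_add (((J a b c d).sub (J a d c b)).sub (J c b d a)) (J c d a b)).trans ?_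
  rw [integral_sub' ((J a b c d).sub (J a d c b)) (J c b d a),
    integral_sub' (J a b c d) (J a d c b), integral_sub (K a d c b) (K a b c d), P, P, P, P]
  have e₁ : dirDeriv a (dirDeriv c (dirDeriv d H)) = dirDeriv c (dirDeriv d (dirDeriv a H)) := by
    rw [hcomm' a c d, hcomm a d]
  have e₂ : dirDeriv c (dirDeriv a (dirDeriv b H)) = dirDeriv a (dirDeriv c (dirDeriv b H)) :=
    hcomm' c a b
  have e₃ : ∀ z, dirDeriv c (dirDeriv d H) z * dirDeriv a (dirDeriv b H) z =
      dirDeriv a (dirDeriv b H) z * dirDeriv c (dirDeriv d H) z := fun z => mul_comm _ _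
  have e₄ : ∀ z, dirDeriv c (dirDeriv b H) z * dirDeriv a (dirDeriv d H) z =
      dirDeriv a (dirDeriv d H) z * dirDeriv c (dirDeriv b H) z := fun z => mul_comm _ _
  rw [e₁, e₂, hcomm d a]
  simp only [e₃, e₄]
  ring

end Integration

section PhaseSpace

variable {n : ℕ} {f : (Fin n → ℝ) × (Fin n → ℝ) → ℝ}

lemma pdq_eq_dirDeriv (hf : Differentiable ℝ f) (j : Fin n) :
    pdq j f = dirDeriv (Pi.single j 1, 0) f := by
  funext z
  have h := (hasDerivAt_update z.1 j (z.1 j)).prodMk (hasDerivAt_const (z.1 j) z.2)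
  have hz : (Function.update z.1 j (z.1 j), z.2) = z := by simp
  exact (HasFDerivAt.comp_hasDerivAt (z.1 j) (by rw [hz]; exact (hf z).hasFDerivAt) h).deriv

lemma pdp_eq_dirDeriv (hf : Differentiable ℝ f) (k : Fin n) :
    pdp k f = dirDeriv (0, Pi.single k 1) f := by
  funext z
  have h := (hasDerivAt_const (z.2 k) z.1).prodMk (hasDerivAt_update z.2 k (z.2 k))
  have hz : (z.1, Function.update z.2 k (z.2 k)) = z := by simp
  exact (HasFDerivAt.comp_hasDerivAt (z.2 k) (by rw [hz]; exact (hf z).hasFDerivAt) h).deriv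

end PhaseSpace

/-- the integration-by-parts identity `Ω₂₃ = 2Ω₂₂` between the two
`ℏ²`-coefficients of the semiclassical expansion of the thermodynamic potential. -/
theorem omega23_eq_two_omega22 {n : ℕ} (H : (Fin n → ℝ) × (Fin n → ℝ) → ℝ)
    (hH : ContDiff ℝ 3 H) (hH1 : ∀ z, 1 ≤ H z)
    (c₀ s : ℝ) (hc₀ : 0 < c₀) (hs : 0 < s)
    (hgrow : ∀ z : (Fin n → ℝ) × (Fin n → ℝ), c₀ * (1 + ‖z‖) ^ s ≤ H z)
    (hder : ∀ k : ℕ, k ≤ 3 → ∃ C : ℝ, ∀ z, ‖iteratedFDeriv ℝ k H z‖ ≤ C * H z)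
    (F : ℝ → ℝ) (hF : ContDiff ℝ 3 F)
    (hFdec : ∀ k : ℕ, k = 2 ∨ k = 3 → ∀ N : ℕ, ∃ C : ℝ,
      ∀ t : ℝ, |iteratedDeriv k F t| ≤ C / (1 + |t|) ^ N)
    (μ : ℝ) :
    Integrable (fun z : (Fin n → ℝ) × (Fin n → ℝ) =>
        iteratedDeriv 3 F (H z - μ) * ∑ j, ∑ k,
          (pdq j H z * pdp j (pdp k H) z * pdq k H z
            - 2 * pdq j H z * pdp k H z * pdp j (pdq k H) z
            + pdp j H z * pdp k H z * pdq j (pdq k H) z)) ∧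
    Integrable (fun z : (Fin n → ℝ) × (Fin n → ℝ) =>
        iteratedDeriv 2 F (H z - μ) * ∑ j, ∑ k,
          (pdq j (pdp k H) z * pdp j (pdq k H) z - pdq j (pdq k H) z * pdp j (pdp k H) z)) ∧
    (∫ z : (Fin n → ℝ) × (Fin n → ℝ),
        iteratedDeriv 3 F (H z - μ) * ∑ j, ∑ k,
          (pdq j H z * pdp j (pdp k H) z * pdq k H z
            - 2 * pdq j H z * pdp k H z * pdp j (pdq k H) z
            + pdp j H z * pdp k H z * pdq j (pdq k H) z))
      = 2 * ∫ z : (Fin n → ℝ) × (Fin n → ℝ),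
          iteratedDeriv 2 F (H z - μ) * ∑ j, ∑ k,
            (pdq j (pdp k H) z * pdp j (pdq k H) z - pdq j (pdq k H) z * pdp j (pdp k H) z) := by
  have hdom : IsDominated H 3 H := ⟨hH, hder⟩
  have hHd : Differentiable ℝ H := hdom.differentiable
  have hDd : ∀ v, Differentiable ℝ (dirDeriv v H) := fun v => (hdom.dirDeriv v).differentiable
  have hF₃ : iteratedDeriv 3 F = deriv (iteratedDeriv 2 F) := iteratedDeriv_succ
  have hg : ContDiff ℝ 1 (iteratedDeriv 2 F) := by
    rw [iteratedDeriv_eq_iterate]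
    exact ContDiff.iterate_deriv' 1 2 hF
  have hdec : HasRapidDecay (iteratedDeriv 2 F) := hFdec 2 (Or.inl rfl)
  have hdec' : HasRapidDecay (deriv (iteratedDeriv 2 F)) := by
    rw [← hF₃]
    exact hFdec 3 (Or.inr rfl)
  obtain ⟨Q, hQ⟩ : ∃ Q : Fin n → (Fin n → ℝ) × (Fin n → ℝ),
      ∀ f, Differentiable ℝ f → ∀ j, pdq j f = dirDeriv (Q j) f :=
    ⟨_, fun _ hf j => pdq_eq_dirDeriv hf j⟩
  obtain ⟨P, hP⟩ : ∃ P : Fin n → (Fin n → ℝ) × (Fin n → ℝ),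
      ∀ f, Differentiable ℝ f → ∀ k, pdp k f = dirDeriv (P k) f :=
    ⟨_, fun _ hf k => pdp_eq_dirDeriv hf k⟩
  simp only [hQ H hHd, hP H hHd, hQ _ (hDd _), hP _ (hDd _), hF₃]
  have : (volume : Measure ((Fin n → ℝ) × (Fin n → ℝ))).IsAddHaarMeasure :=
    Measure.prod.instIsAddHaarMeasure (volume : Measure (Fin n → ℝ)) volume
  have key := fun j k => integral_deriv_comp_mul_hessian (ν := volume) hH1 hc₀ hs hgrow hg hdec
    hdec' μ hdom (Q j) (Q k) (P j) (P k)
  have hsum : ∀ z, ∑ j, ∑ k,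
      (dirDeriv (Q j) H z * dirDeriv (P j) (dirDeriv (P k) H) z * dirDeriv (Q k) H z
        - 2 * dirDeriv (Q j) H z * dirDeriv (P k) H z * dirDeriv (P j) (dirDeriv (Q k) H) z
        + dirDeriv (P j) H z * dirDeriv (P k) H z * dirDeriv (Q j) (dirDeriv (Q k) H) z)
      = ∑ j, ∑ k,
      (dirDeriv (Q j) H z * dirDeriv (Q k) H z * dirDeriv (P j) (dirDeriv (P k) H) z
        - dirDeriv (Q j) H z * dirDeriv (P k) H z * dirDeriv (P j) (dirDeriv (Q k) H) z
        - dirDeriv (P j) H z * dirDeriv (Q k) H z * dirDeriv (P k) (dirDeriv (Q j) H) z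
        + dirDeriv (P j) H z * dirDeriv (P k) H z * dirDeriv (Q j) (dirDeriv (Q k) H) z) := by
    intro z
    have hswap : ∑ j, ∑ k,
        dirDeriv (P j) H z * dirDeriv (Q k) H z * dirDeriv (P k) (dirDeriv (Q j) H) z
        = ∑ j, ∑ k,
        dirDeriv (Q j) H z * dirDeriv (P k) H z * dirDeriv (P j) (dirDeriv (Q k) H) z := by
      rw [Finset.sum_comm]
      exact Finset.sum_congr rfl fun j _ => Finset.sum_congr rfl fun k _ => by ring
    calc _ = ∑ j, ∑ k,
          (dirDeriv (Q j) H z * dirDeriv (Q k) H z * dirDeriv (P j) (dirDeriv (P k) H) z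
            - dirDeriv (Q j) H z * dirDeriv (P k) H z * dirDeriv (P j) (dirDeriv (Q k) H) z
            - dirDeriv (Q j) H z * dirDeriv (P k) H z * dirDeriv (P j) (dirDeriv (Q k) H) z
            + dirDeriv (P j) H z * dirDeriv (P k) H z * dirDeriv (Q j) (dirDeriv (Q k) H) z) :=
        Finset.sum_congr rfl fun j _ => Finset.sum_congr rfl fun k _ => by ring
      _ = _ := by
        simp only [Finset.sum_add_distrib, Finset.sum_sub_distrib, hswap]
  simp only [hsum, Finset.mul_sum]
  refine ⟨integrable_finsetSum _ fun j _ => integrable_finsetSum _ fun k _ => (key j k).1,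
    integrable_finsetSum _ fun j _ => integrable_finsetSum _ fun k _ => (key j k).2.1, ?_⟩
  rw [integral_finsetSum _ fun j _ => integrable_finsetSum _ fun k _ => (key j k).1,
    integral_finsetSum _ fun j _ => integrable_finsetSum _ fun k _ => (key j k).2.1,
    Finset.mul_sum]
  refine Finset.sum_congr rfl fun j _ => ?_
  rw [integral_finsetSum _ fun k _ => (key j k).1,
    integral_finsetSum _ fun k _ => (key j k).2.1, Finset.mul_sum]
  exact Finset.sum_congr rfl fun k _ => (key j k).2.2
end

section
/- Let H : ℝⁿ × ℝⁿ → ℝ be continuously differentiable, let μ ∈ ℝ, and suppose the energy surface Σ_μ = {z ∈ ℝ²ⁿ : H(z) = μ} is compact, nonempty, and contains no critical point of H. Then there exists τ₀ > 0 such that for every differentiable curve γ = (q,p) : ℝ → ℝⁿ × ℝⁿ solving Hamilton's equations q'(t) = ∂H/∂p(γ(t)), p'(t) = -∂H/∂q(γ(t)) with H(γ(0)) = μ, and every T with 0 < T ≤ τ₀, one has γ(T) ≠ γ(0). In other words, the Hamiltonian flow on Σ_μ has no periodic point with period in (0, τ₀]. -/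
/-- Integral curves of a continuous, nowhere vanishing vector field on a compact set have no
arbitrarily short periods. -/
theorem exists_pos_forall_integralCurve_ne {E : Type*} [NormedAddCommGroup E] [NormedSpace ℝ E]
    {K : Set E} (hK : IsCompact K) {X : E → E} (hX : ContinuousOn X K)
    (hX0 : ∀ z ∈ K, X z ≠ 0) :
    ∃ τ > 0, ∀ γ : ℝ → E, (∀ t, HasDerivAt γ (X (γ t)) t) → (∀ t, γ t ∈ K) →
      ∀ T : ℝ, 0 < T → T ≤ τ → γ T ≠ γ 0 := by
  rcases K.eq_empty_or_nonempty with rfl | hne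
  · exact ⟨1, one_pos, fun γ _ hmem => (hmem 0).elim⟩
  obtain ⟨z₀, hz₀, hmin⟩ := hK.exists_isMinOn hne hX.norm
  obtain ⟨M, hM⟩ := hK.exists_bound_of_continuousOn hX
  have hm : 0 < ‖X z₀‖ := norm_pos_iff.mpr (hX0 z₀ hz₀)
  have hM0 : 0 ≤ M := (norm_nonneg _).trans (hM z₀ hz₀)
  obtain ⟨δ, hδ, hδX⟩ := Metric.uniformContinuousOn_iff.mp
    (hK.uniformContinuousOn_of_continuous hX) (‖X z₀‖ / 2) (half_pos hm)
  refine ⟨δ / (M + 1), by positivity, fun γ hγ hmem T hT hTτ heq => ?_⟩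
  have hclose : ∀ t ∈ Set.Icc 0 T, ‖γ t - γ 0‖ < δ := by
    intro t ht
    have h := norm_image_sub_le_of_norm_deriv_le_segment'
      (fun s _ => (hγ s).hasDerivWithinAt) (fun s _ => hM _ (hmem s)) t ht
    have h1 : T * (M + 1) ≤ δ := (le_div_iff₀ (by positivity)).mp hTτ
    nlinarith [mul_le_mul_of_nonneg_left ht.2 hM0]
  have hdrift := norm_image_sub_le_of_norm_deriv_le_segment'
    (f := fun t => γ t - t • X (γ 0)) (f' := fun t => X (γ t) - X (γ 0)) (C := ‖X z₀‖ / 2)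
    (a := 0) (b := T)
    (fun s _ => by
      simpa using ((hγ s).fun_sub ((hasDerivAt_id s).smul_const (X (γ 0)))).hasDerivWithinAt)
    (fun s hs => by
      rw [← dist_eq_norm]
      refine (hδX _ (hmem s) _ (hmem 0) ?_).le
      rw [dist_eq_norm]
      exact hclose s (Set.Ico_subset_Icc_self hs))
    T (Set.right_mem_Icc.mpr hT.le)
  have hmin0 : ‖X z₀‖ ≤ ‖X (γ 0)‖ := hmin (hmem 0)
  simp only [heq, zero_smul, sub_zero, sub_sub_cancel_left, norm_neg, norm_smul,
    Real.norm_of_nonneg hT.le] at hdrift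
  nlinarith

section Hamiltonian

variable {F : Type*} [NormedAddCommGroup F] [InnerProductSpace ℝ F] [CompleteSpace F]

/-- The Hamiltonian vector field `(∂H/∂p, -∂H/∂q)` on `F × F`. -/
noncomputable def hamiltonianField (H : F × F → ℝ) (z : F × F) : F × F :=
  (gradient (fun p => H (z.1, p)) z.2, -gradient (fun q => H (q, z.2)) z.1)

theorem gradient_comp_prodMk_left {H : F × F → ℝ} {z : F × F} (hH : DifferentiableAt ℝ H z) :
    gradient (fun q => H (q, z.2)) z.1 =
      (InnerProductSpace.toDual ℝ F).symm ((fderiv ℝ H z).comp (.inl ℝ F F)) := by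
  have h : HasFDerivAt (fun q => H (q, z.2)) ((fderiv ℝ H z).comp (.inl ℝ F F)) z.1 :=
    hH.hasFDerivAt.comp z.1 (hasFDerivAt_prodMk_left z.1 z.2)
  rw [gradient, h.fderiv]

theorem gradient_comp_prodMk_right {H : F × F → ℝ} {z : F × F} (hH : DifferentiableAt ℝ H z) :
    gradient (fun p => H (z.1, p)) z.2 =
      (InnerProductSpace.toDual ℝ F).symm ((fderiv ℝ H z).comp (.inr ℝ F F)) := by
  have h : HasFDerivAt (fun p => H (z.1, p)) ((fderiv ℝ H z).comp (.inr ℝ F F)) z.2 :=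
    hH.hasFDerivAt.comp z.2 (hasFDerivAt_prodMk_right z.1 z.2)
  rw [gradient, h.fderiv]

theorem continuous_hamiltonianField {H : F × F → ℝ} (hH : ContDiff ℝ 1 H) :
    Continuous (hamiltonianField H) := by
  have hd : Differentiable ℝ H := hH.differentiable one_ne_zero
  have hc : Continuous (fderiv ℝ H) := hH.continuous_fderiv one_ne_zero
  have heq : hamiltonianField H = fun z =>
      ((InnerProductSpace.toDual ℝ F).symm ((fderiv ℝ H z).comp (.inr ℝ F F)),
        -(InnerProductSpace.toDual ℝ F).symm ((fderiv ℝ H z).comp (.inl ℝ F F))) := by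
    funext z
    rw [hamiltonianField, gradient_comp_prodMk_left (hd z), gradient_comp_prodMk_right (hd z)]
  rw [heq]
  exact ((InnerProductSpace.toDual ℝ F).symm.continuous.comp (hc.clm_comp continuous_const)).prodMk
    ((InnerProductSpace.toDual ℝ F).symm.continuous.comp (hc.clm_comp continuous_const)).neg

theorem fderiv_apply_eq_inner_gradient {H : F × F → ℝ} {z : F × F}
    (hH : DifferentiableAt ℝ H z) (v : F × F) :
    fderiv ℝ H z v = inner ℝ (gradient (fun q => H (q, z.2)) z.1) v.1 +
      inner ℝ (gradient (fun p => H (z.1, p)) z.2) v.2 := by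
  rw [gradient_comp_prodMk_left hH, gradient_comp_prodMk_right hH,
    InnerProductSpace.toDual_symm_apply, InnerProductSpace.toDual_symm_apply]
  simp [← map_add]

theorem fderiv_hamiltonianField {H : F × F → ℝ} {z : F × F} (hH : DifferentiableAt ℝ H z) :
    fderiv ℝ H z (hamiltonianField H z) = 0 := by
  rw [fderiv_apply_eq_inner_gradient hH, hamiltonianField, inner_neg_right, real_inner_comm]
  exact add_neg_cancel _

theorem fderiv_eq_zero_of_hamiltonianField_eq_zero {H : F × F → ℝ} {z : F × F}
    (hH : DifferentiableAt ℝ H z) (hz : hamiltonianField H z = 0) : fderiv ℝ H z = 0 := by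
  obtain ⟨hp, hq⟩ := Prod.mk.inj hz
  ext v <;> simp [fderiv_apply_eq_inner_gradient hH, hp, neg_eq_zero.mp hq]

/-- Conservation of energy along solutions of Hamilton's equations. -/
theorem hamiltonian_conserved {H : F × F → ℝ} (hH : Differentiable ℝ H) {γ : ℝ → F × F}
    (hγ : ∀ t, HasDerivAt γ (hamiltonianField H (γ t)) t) (s t : ℝ) : H (γ s) = H (γ t) := by
  have hderiv : ∀ t, HasDerivAt (H ∘ γ) 0 t := fun t => by
    simpa only [fderiv_hamiltonianField (hH (γ t))] using
      (hH (γ t)).hasFDerivAt.comp_hasDerivAt t (hγ t)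
  exact is_const_of_deriv_eq_zero (fun t => (hderiv t).differentiableAt)
    (fun t => (hderiv t).deriv) s t

end Hamiltonian


/-- on a compact, nonempty, non-critical energy surface
`Σ_μ = {H = μ}`, the Hamiltonian flow has no periodic point with period in
`(0, τ₀]` for some `τ₀ > 0`: any solution of Hamilton's equations
`q' = ∂H/∂p`, `p' = -∂H/∂q` starting on `Σ_μ` satisfies `γ(T) ≠ γ(0)` for
`0 < T ≤ τ₀`. -/
theorem no_short_periodic_orbits {n : ℕ}
    (H : EuclideanSpace ℝ (Fin n) × EuclideanSpace ℝ (Fin n) → ℝ)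
    (hH : ContDiff ℝ 1 H) (μ : ℝ)
    (hcompact : IsCompact {z : EuclideanSpace ℝ (Fin n) × EuclideanSpace ℝ (Fin n) | H z = μ})
    (hne : {z : EuclideanSpace ℝ (Fin n) × EuclideanSpace ℝ (Fin n) | H z = μ}.Nonempty)
    (hnc : ∀ z : EuclideanSpace ℝ (Fin n) × EuclideanSpace ℝ (Fin n),
      H z = μ → fderiv ℝ H z ≠ 0) :
    ∃ τ₀ > 0, ∀ γ : ℝ → EuclideanSpace ℝ (Fin n) × EuclideanSpace ℝ (Fin n),
      (∀ t : ℝ,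
        HasDerivAt (fun s => (γ s).1) (gradient (fun p => H ((γ t).1, p)) (γ t).2) t ∧
        HasDerivAt (fun s => (γ s).2) (-gradient (fun q => H (q, (γ t).2)) (γ t).1) t) →
      H (γ 0) = μ →
      ∀ T : ℝ, 0 < T → T ≤ τ₀ → γ T ≠ γ 0 := by
  have hd : Differentiable ℝ H := hH.differentiable one_ne_zero
  obtain ⟨τ, hτ, hτγ⟩ := exists_pos_forall_integralCurve_ne hcompact
    (continuous_hamiltonianField hH).continuousOn
    (fun z hz h0 => hnc z hz (fderiv_eq_zero_of_hamiltonianField_eq_zero (hd z) h0))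
  refine ⟨τ, hτ, fun γ hγ h0 => ?_⟩
  have hγ' : ∀ t, HasDerivAt γ (hamiltonianField H (γ t)) t :=
    fun t => (hγ t).1.prodMk (hγ t).2
  exact hτγ γ hγ' fun t => (hamiltonian_conserved hd hγ' t 0).trans h0
end
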